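/- arXiv:2203.09342 — 2 statements merged into one kernel-verified Lean document; each statement's English description precedes it below -/
import Mathlib

section
/- Let k be a natural number with 2 ≤ k ≤ n. Every S_n-invariant element of A_f that lies in the A-subalgebra Algebra.adjoin A {τ_j : j ∈ Fin n, k ≤ j} lies in the image of algebraMap A A_f. -/
open MvPolynomial

noncomputable section

/-- The ideal defining the splitting algebra of `f = Xⁿ + a₁Xⁿ⁻¹ + ⋯ + aₙ`. -/
def splittingIdeal (A : Type*) [CommRing A] (n : ℕ) (a : Fin n → A) :
    Ideal (MvPolynomial (Fin n) A) :=
  Ideal.span (Set.range fun k : Fin n =>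
    esymm (Fin n) A (k.1 + 1) - C ((-1 : A) ^ (k.1 + 1) * a k))

/-- The splitting algebra `A_f`. -/
abbrev SplittingAlg (A : Type*) [CommRing A] (n : ℕ) (a : Fin n → A) : Type _ :=
  MvPolynomial (Fin n) A ⧸ splittingIdeal A n a

/-- The quotient map `π`. -/
def splittingMk (A : Type*) [CommRing A] (n : ℕ) (a : Fin n → A) :
    MvPolynomial (Fin n) A →ₐ[A] SplittingAlg A n a :=
  Ideal.Quotient.mkₐ A (splittingIdeal A n a)

/-- The universal roots `τᵢ`. -/
def tau (A : Type*) [CommRing A] (n : ℕ) (a : Fin n → A) (i : Fin n) :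
    SplittingAlg A n a :=
  splittingMk A n a (X i)

theorem rename_mem_splittingIdeal (A : Type*) [CommRing A] (n : ℕ) (a : Fin n → A)
    (σ : Equiv.Perm (Fin n)) {p : MvPolynomial (Fin n) A}
    (hp : p ∈ splittingIdeal A n a) :
    rename (σ : Fin n → Fin n) p ∈ splittingIdeal A n a := by
  have h : (splittingIdeal A n a).map ((rename (σ : Fin n → Fin n)).toRingHom :
      MvPolynomial (Fin n) A →+* MvPolynomial (Fin n) A) ≤ splittingIdeal A n a := by
    rw [splittingIdeal, Ideal.map_span]
    refine Ideal.span_le.2 ?_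
    rintro _ ⟨_, ⟨k, rfl⟩, rfl⟩
    have hren : (rename (σ : Fin n → Fin n))
        (esymm (Fin n) A (k.1 + 1) - C ((-1 : A) ^ (k.1 + 1) * a k))
        = esymm (Fin n) A (k.1 + 1) - C ((-1 : A) ^ (k.1 + 1) * a k) := by
      rw [map_sub, esymm_isSymmetric (Fin n) A (k.1 + 1) σ, rename_C]
    show (rename (σ : Fin n → Fin n))
        (esymm (Fin n) A (k.1 + 1) - C ((-1 : A) ^ (k.1 + 1) * a k)) ∈ _
    rw [hren]
    exact Ideal.subset_span ⟨k, rfl⟩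
  exact h (Ideal.mem_map_of_mem _ hp)

/-- The action of a permutation `σ` on the splitting algebra, as an `A`-algebra map. -/
def permHom (A : Type*) [CommRing A] (n : ℕ) (a : Fin n → A) (σ : Equiv.Perm (Fin n)) :
    SplittingAlg A n a →ₐ[A] SplittingAlg A n a :=
  Ideal.Quotient.liftₐ (splittingIdeal A n a)
    ((splittingMk A n a).comp (rename (σ : Fin n → Fin n)))
    (fun p hp => by
      have h := rename_mem_splittingIdeal A n a σ hp
      show Ideal.Quotient.mkₐ A (splittingIdeal A n a) _ = 0
      rw [Ideal.Quotient.mkₐ_eq_mk]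
      exact (Ideal.Quotient.eq_zero_iff_mem).2 h)

/-- The trivial `G`-invariants of the splitting algebra. -/
def trivialInv (A : Type*) [CommRing A] (n : ℕ) (a : Fin n → A)
    (G : Subgroup (Equiv.Perm (Fin n))) : Set (SplittingAlg A n a) :=
  splittingMk A n a '' {p | ∀ σ ∈ G, rename (σ : Fin n → Fin n) p = p}

/-- The element `D_f = ∏_{i<j} (τᵢ + τⱼ)`. -/
def Df (A : Type*) [CommRing A] (n : ℕ) (a : Fin n → A) : SplittingAlg A n a :=
  ∏ p ∈ Finset.univ.filter (fun p : Fin n × Fin n => p.1 < p.2),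
    (tau A n a p.1 + tau A n a p.2)

end

section Splitting

open Polynomial

universe u

/-- Every monic polynomial splits in a faithful extension in which the last of its roots
is as generic as possible. -/
theorem exists_faithful_splitting (m : ℕ) : ∀ (B : Type u) [CommRing B] (q : B[X]), q.Monic →
    q.natDegree = m → ∃ (E : Type u) (_ : CommRing E) (_ : Algebra B E) (t : ℕ → E),
      Function.Injective (algebraMap B E) ∧
      q.map (algebraMap B E) = ∏ l ∈ Finset.range m, (Polynomial.X - Polynomial.C (t l)) ∧
      ∀ i, i + 1 = m → ∀ p : B[X], p.natDegree ≤ i → Polynomial.aeval (t i) p = 0 → p = 0 := by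
  induction m with
  | zero =>
    intro B _ q hq hd
    refine ⟨B, inferInstance, inferInstance, 0, Function.injective_id, ?_, by simp⟩
    simp [hq.natDegree_eq_zero.1 hd]
  | succ m ih =>
    intro B _ q hq hd
    have hB : Nontrivial B := by
      by_contra h
      rw [not_nontrivial_iff_subsingleton] at h
      simp [Subsingleton.elim q 0] at hd
    have hgen : ∀ p : B[X], p.natDegree ≤ m → AdjoinRoot.mk q p = 0 → p = 0 := by
      intro p hp h0
      by_contra hne
      exact AdjoinRoot.mk_ne_zero_of_natDegree_lt hq hne (by omega) h0
    have hinj : Function.Injective (algebraMap B (AdjoinRoot q)) := by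
      rw [injective_iff_map_eq_zero]
      intro b hb
      rw [AdjoinRoot.algebraMap_eq, ← AdjoinRoot.mk_C] at hb
      exact Polynomial.C_eq_zero.1 (hgen _ (by simp) hb)
    have hB' : Nontrivial (AdjoinRoot q) := hinj.nontrivial
    obtain ⟨q', hq'⟩ := Polynomial.dvd_iff_isRoot.2 (AdjoinRoot.isRoot_root q)
    have hqm : (q.map (AdjoinRoot.of q)).Monic := hq.map _
    have hmon : q'.Monic := by
      rw [hq'] at hqm
      exact (Polynomial.monic_X_sub_C _).of_mul_monic_left hqm
    have hdeg : q'.natDegree = m := by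
      have h := hq.natDegree_map (AdjoinRoot.of q)
      rw [hq', (Polynomial.monic_X_sub_C _).natDegree_mul hmon, Polynomial.natDegree_X_sub_C,
        hd] at h
      omega
    obtain ⟨E, _, _, t, hE, ht, -⟩ := ih (AdjoinRoot q) q' hmon hdeg
    let _ : Algebra B E := ((algebraMap (AdjoinRoot q) E).comp (algebraMap B _)).toAlgebra
    have : IsScalarTower B (AdjoinRoot q) E := IsScalarTower.of_algebraMap_eq' rfl
    refine ⟨E, inferInstance, inferInstance,
      fun l => if l = m then algebraMap _ E (AdjoinRoot.root q) else t l, hE.comp hinj, ?_, ?_⟩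
    · rw [Finset.prod_range_succ, IsScalarTower.algebraMap_eq B (AdjoinRoot q) E,
        ← Polynomial.map_map, AdjoinRoot.algebraMap_eq, hq', Polynomial.map_mul, ht, mul_comm]
      congr 1
      · refine Finset.prod_congr rfl fun l hl => ?_
        simp only [if_neg (Finset.mem_range.1 hl).ne]
      · simp
    · intro i hi p hp h0
      obtain rfl : i = m := by omega
      refine hgen p hp (hE ?_)
      simp only [if_true] at h0
      rwa [Polynomial.aeval_algebraMap_apply, AdjoinRoot.aeval_eq,
        ← map_zero (algebraMap (AdjoinRoot q) E)] at h0

variable (A : Type u) [CommRing A] (n : ℕ) (a : Fin n → A)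

/-- The polynomial whose universal roots are adjoined in the splitting algebra. -/
noncomputable def universalPoly : A[X] :=
  Polynomial.X ^ n + ∑ k : Fin n, Polynomial.C (a k) * Polynomial.X ^ (n - 1 - k.1)

theorem universalPoly_coeff (k : Fin n) : (universalPoly A n a).coeff (n - (k.1 + 1)) = a k := by
  have hk := k.2
  rw [universalPoly, Polynomial.coeff_add, Polynomial.coeff_X_pow, if_neg (by omega), zero_add,
    Polynomial.finsetSum_coeff, Finset.sum_eq_single k]
  · simp [show n - (k.1 + 1) = n - 1 - k.1 by omega]
  · intro b _ hb
    rw [Polynomial.coeff_C_mul, Polynomial.coeff_X_pow, if_neg, mul_zero]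
    intro h
    have := b.2
    exact hb (Fin.ext (by omega))
  · simp

theorem universalPoly_coeff_of_le {m : ℕ} (hm : n ≤ m) :
    (universalPoly A n a).coeff m = if m = n then 1 else 0 := by
  rw [universalPoly, Polynomial.coeff_add, Polynomial.coeff_X_pow, Polynomial.finsetSum_coeff,
    Finset.sum_eq_zero, add_zero]
  intro b _
  have := b.2
  rw [Polynomial.coeff_C_mul, Polynomial.coeff_X_pow, if_neg (by omega), mul_zero]

variable {A n}

theorem prod_X_sub_C_coeff_esymm {E : Type*} [CommRing E] [Algebra A E] (t : Fin n → E)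
    (k : Fin n) :
    (∏ i, (Polynomial.X - Polynomial.C (t i))).coeff (n - (k.1 + 1)) =
      (-1) ^ (k.1 + 1) * MvPolynomial.aeval t (esymm (Fin n) A (k.1 + 1)) := by
  have hk := k.2
  have h := Multiset.prod_X_sub_C_coeff (Finset.univ.val.map t) (k := n - (k.1 + 1)) (by simp)
  rw [Multiset.map_map] at h
  rw [aeval_esymm_eq_multiset_esymm]
  simp only [Multiset.card_map, Finset.card_val, Finset.card_univ, Fintype.card_fin] at h
  rw [show n - (n - (k.1 + 1)) = k.1 + 1 by omega] at h
  exact h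

theorem map_universalPoly_eq_prod_iff {E : Type*} [CommRing E] [Algebra A E] (t : Fin n → E) :
    (universalPoly A n a).map (algebraMap A E) = ∏ i, (Polynomial.X - Polynomial.C (t i)) ↔
      ∀ k : Fin n, MvPolynomial.aeval t (esymm (Fin n) A (k.1 + 1)) =
        algebraMap A E ((-1) ^ (k.1 + 1) * a k) := by
  have hsq : ∀ k : ℕ, ((-1 : E) ^ k) * (-1) ^ k = 1 := fun k => by
    rw [← mul_pow]; simp
  constructor
  · intro h k
    have := prod_X_sub_C_coeff_esymm (A := A) t k
    rw [← h, Polynomial.coeff_map, universalPoly_coeff] at this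
    rw [map_mul, this, map_pow, map_neg, map_one, ← mul_assoc, hsq, one_mul]
  · intro h
    nontriviality E
    have hm : (∏ i, (Polynomial.X - Polynomial.C (t i))).Monic :=
      Polynomial.monic_prod_of_monic _ _ fun i _ => Polynomial.monic_X_sub_C _
    have hd : (∏ i, (Polynomial.X - Polynomial.C (t i))).natDegree = n := by
      rw [Polynomial.natDegree_prod_of_monic _ _ fun i _ => Polynomial.monic_X_sub_C _]
      simp
    ext m
    rw [Polynomial.coeff_map]
    rcases lt_or_ge m n with hmn | hmn
    · have hk : m = n - ((⟨n - 1 - m, by omega⟩ : Fin n).1 + 1) := by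
        simp only; omega
      rw [hk, universalPoly_coeff, prod_X_sub_C_coeff_esymm (A := A), h, map_mul, map_pow, map_neg,
        map_one, ← mul_assoc, hsq, one_mul]
    · rw [universalPoly_coeff_of_le _ _ _ hmn]
      split_ifs with hmn'
      · have := hm.coeff_natDegree
        rw [hd] at this
        rw [hmn', this, map_one]
      · rw [Polynomial.coeff_eq_zero_of_natDegree_lt (by omega), map_zero]

/-- The universal root of index `l`, extended by zero to all natural numbers. -/
noncomputable def natTau (l : ℕ) : SplittingAlg A n a :=
  if h : l < n then tau A n a ⟨l, h⟩ else 0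

@[simp] theorem natTau_val (i : Fin n) : natTau a i.1 = tau A n a i := by
  simp [natTau]

theorem map_universalPoly :
    (universalPoly A n a).map (algebraMap A (SplittingAlg A n a)) =
      ∏ l ∈ Finset.range n, (Polynomial.X - Polynomial.C (natTau a l)) := by
  rw [Finset.prod_range]
  simp only [natTau_val]
  rw [map_universalPoly_eq_prod_iff]
  intro k
  have h : MvPolynomial.aeval (tau A n a) = splittingMk A n a := by
    ext i
    simp [tau]
  rw [h, ← sub_eq_zero, ← (splittingMk A n a).commutes, ← map_sub]
  exact Ideal.Quotient.eq_zero_iff_mem.2 (Ideal.subset_span ⟨k, rfl⟩)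

theorem exists_algHom_of_map_universalPoly {E : Type*} [CommRing E] [Algebra A E] (t : ℕ → E)
    (ht : (universalPoly A n a).map (algebraMap A E) =
      ∏ l ∈ Finset.range n, (Polynomial.X - Polynomial.C (t l))) :
    ∃ φ : SplittingAlg A n a →ₐ[A] E, ∀ i, φ (tau A n a i) = t i.1 := by
  rw [Finset.prod_range, map_universalPoly_eq_prod_iff] at ht
  refine ⟨Ideal.Quotient.liftₐ _ (MvPolynomial.aeval fun i : Fin n => t i.1) ?_, fun i => ?_⟩
  · suffices h : splittingIdeal A n a ≤
        RingHom.ker (MvPolynomial.aeval (R := A) fun i : Fin n => t i.1) from fun p hp => h hp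
    rw [splittingIdeal, Ideal.span_le]
    rintro _ ⟨k, rfl⟩
    simp only [SetLike.mem_coe, RingHom.mem_ker, map_sub, ht k, MvPolynomial.aeval_C, sub_self]
  · exact MvPolynomial.aeval_X _ _

/-- The subalgebra generated by the universal roots of index at least `m`. -/
noncomputable abbrev tailAlg (m : ℕ) : Subalgebra A (SplittingAlg A n a) :=
  Algebra.adjoin A {y | ∃ j : Fin n, m ≤ (j : ℕ) ∧ y = tau A n a j}

theorem natTau_mem_tailAlg {m l : ℕ} (h : m ≤ l) : natTau a l ∈ tailAlg a m := by
  unfold natTau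
  split_ifs with hl
  · exact Algebra.subset_adjoin ⟨⟨l, hl⟩, h, rfl⟩
  · exact zero_mem _

theorem exists_tailAlg_factor [Nontrivial (SplittingAlg A n a)] {m : ℕ} (hm : m ≤ n) :
    ∃ q : (tailAlg a m)[X], q.Monic ∧ q.natDegree = m ∧
      q.map (algebraMap _ (SplittingAlg A n a)) =
        ∏ l ∈ Finset.range m, (Polynomial.X - Polynomial.C (natTau a l)) ∧
      (universalPoly A n a).map (algebraMap A (tailAlg a m)) =
        q * ∏ l ∈ Finset.Ico m n, (Polynomial.X - Polynomial.C
          (if h : m ≤ l then ⟨natTau a l, natTau_mem_tailAlg a h⟩ else 0)) := by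
  set g : (tailAlg a m)[X] := ∏ l ∈ Finset.Ico m n, (Polynomial.X - Polynomial.C
          (if h : m ≤ l then ⟨natTau a l, natTau_mem_tailAlg a h⟩ else 0)) with hg
  have hgm : g.Monic := Polynomial.monic_prod_of_monic _ _ fun i _ => Polynomial.monic_X_sub_C _
  have hinj : Function.Injective (algebraMap (tailAlg a m) (SplittingAlg A n a)) :=
    Subtype.val_injective
  have hgmap : g.map (algebraMap _ (SplittingAlg A n a)) =
      ∏ l ∈ Finset.Ico m n, (Polynomial.X - Polynomial.C (natTau a l)) := by
    rw [hg, Polynomial.map_prod]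
    refine Finset.prod_congr rfl fun l hl => ?_
    rw [dif_pos (Finset.mem_Ico.1 hl).1, Polynomial.map_sub, Polynomial.map_X, Polynomial.map_C]
    rfl
  have hf : ((universalPoly A n a).map (algebraMap A (tailAlg a m))).map
      (algebraMap _ (SplittingAlg A n a)) = g.map (algebraMap _ (SplittingAlg A n a)) *
        ∏ l ∈ Finset.range m, (Polynomial.X - Polynomial.C (natTau a l)) := by
    rw [Polynomial.map_map, ← IsScalarTower.algebraMap_eq, map_universalPoly, hgmap,
      ← Finset.prod_range_mul_prod_Ico _ hm]
    exact mul_comm (G := (SplittingAlg A n a)[X]) _ _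
  have hq : ((universalPoly A n a).map (algebraMap A (tailAlg a m)) /ₘ g).map
      (algebraMap _ (SplittingAlg A n a)) =
        ∏ l ∈ Finset.range m, (Polynomial.X - Polynomial.C (natTau a l)) := by
    rw [Polynomial.map_divByMonic _ hgm, hf, Polynomial.mul_divByMonic_cancel_left _ (hgm.map _)]
  refine ⟨_, ?_, ?_, hq, ?_⟩
  · refine Polynomial.monic_of_injective hinj ?_
    rw [hq]
    exact Polynomial.monic_prod_of_monic _ _ fun i _ => Polynomial.monic_X_sub_C _
  · rw [← Polynomial.natDegree_map_eq_of_injective hinj, hq,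
      Polynomial.natDegree_prod_of_monic _ _ fun i _ => Polynomial.monic_X_sub_C _]
    simp
  · apply Polynomial.map_injective _ hinj
    rw [Polynomial.map_mul, hq, hf]
    exact mul_comm (G := (SplittingAlg A n a)[X]) _ _

/-- The powers `1, τᵢ, …, τᵢⁱ` are linearly independent over the later roots. -/
theorem eq_zero_of_aeval_tau_eq_zero [Nontrivial (SplittingAlg A n a)] (i : Fin n)
    {m : ℕ} (hm : i.1 + 1 = m) (p : (tailAlg a m)[X]) (hp : p.natDegree ≤ i)
    (h0 : Polynomial.aeval (tau A n a i) p = 0) : p = 0 := by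
  subst hm
  obtain ⟨q, hqm, hqd, -, hq⟩ := exists_tailAlg_factor a (m := i.1 + 1) i.2
  obtain ⟨E, _, _, t, -, ht, hgen⟩ := exists_faithful_splitting _ _ q hqm hqd
  let B := tailAlg a (i.1 + 1)
  let _ : Algebra A E := ((algebraMap B E).comp (algebraMap A _)).toAlgebra
  have : IsScalarTower A B E := IsScalarTower.of_algebraMap_eq' rfl
  obtain ⟨φ, hφ⟩ := exists_algHom_of_map_universalPoly (A := A) a (fun l => if h : i.1 + 1 ≤ l then
      algebraMap B E ⟨natTau a l, natTau_mem_tailAlg a h⟩ else t l) (by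
    rw [IsScalarTower.algebraMap_eq A B E, ← Polynomial.map_map, hq, Polynomial.map_mul, ht,
      Polynomial.map_prod, ← Finset.prod_range_mul_prod_Ico _ (show i.1 + 1 ≤ n from i.2)]
    congr 1
    · refine Finset.prod_congr rfl fun l hl => ?_
      rw [dif_neg (by simpa using hl)]
    · refine Finset.prod_congr rfl fun l hl => ?_
      have hl' := (Finset.mem_Ico.1 hl).1
      simp only [dif_pos hl', Polynomial.map_sub, Polynomial.map_X, Polynomial.map_C])
  have hφB : φ.comp B.val = IsScalarTower.toAlgHom A B E := by
    refine AlgHom.adjoin_ext ?_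
    rintro _ ⟨j, hj, rfl⟩
    rw [AlgHom.comp_apply, Subalgebra.val_apply, hφ, dif_pos hj, IsScalarTower.toAlgHom_apply]
    simp only [natTau_val]
    rfl
  refine hgen i.1 rfl p hp ?_
  have hti : φ (tau A n a i) = t i := by rw [hφ, dif_neg (by omega)]
  have h1 := congrArg φ h0
  rw [map_zero, Polynomial.aeval_def, ← AlgHom.coe_toRingHom, Polynomial.hom_eval₂,
    AlgHom.coe_toRingHom, hti] at h1
  rw [Polynomial.aeval_def, ← h1]
  congr 1
  exact (congrArg AlgHom.toRingHom hφB).symm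

theorem permHom_tau (σ : Equiv.Perm (Fin n)) (i : Fin n) :
    permHom A n a σ (tau A n a i) = tau A n a (σ i) := by
  change splittingMk A n a (rename σ (MvPolynomial.X i)) = _
  rw [rename_X]
  rfl

theorem tailAlg_anti {l m : ℕ} (h : l ≤ m) : tailAlg a m ≤ tailAlg a l :=
  Algebra.adjoin_mono fun _ ⟨j, hj, hy⟩ => ⟨j, h.trans hj, hy⟩

theorem permHom_swap_eq_self (i j : Fin n) (h : j ≤ i) {b : SplittingAlg A n a}
    (hb : b ∈ tailAlg a (i.1 + 1)) : permHom A n a (Equiv.swap j i) b = b := by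
  suffices H : tailAlg a (i.1 + 1) ≤
      AlgHom.equalizer (permHom A n a (Equiv.swap j i)) (AlgHom.id A _) from H hb
  refine Algebra.adjoin_le ?_
  rintro _ ⟨l, hl, rfl⟩
  change permHom A n a (Equiv.swap j i) (tau A n a l) = tau A n a l
  have h' : j.1 ≤ i.1 := h
  rw [permHom_tau, Equiv.swap_apply_of_ne_of_ne] <;> rintro rfl <;> omega

theorem sum_natTau_mem_tailAlg [Nontrivial (SplittingAlg A n a)] {m : ℕ} (hm : m ≤ n) :
    ∑ l ∈ Finset.range m, natTau a l ∈ tailAlg a m := by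
  rcases Nat.eq_zero_or_pos m with rfl | hpos
  · simp
  obtain ⟨q, -, -, hq, -⟩ := exists_tailAlg_factor a hm
  have h := Polynomial.prod_X_sub_C_coeff_card_pred (Finset.range m) (natTau a) (by simpa)
  rw [← hq, Polynomial.coeff_map, eq_comm, neg_eq_iff_eq_neg] at h
  rw [h]
  exact neg_mem (Subtype.property _)

theorem exists_aeval_tau_eq [Nontrivial (SplittingAlg A n a)] (i : Fin n)
    {x : SplittingAlg A n a} (hx : x ∈ tailAlg a i.1) :
    ∃ p : (tailAlg a (i.1 + 1))[X], p.natDegree ≤ i ∧ Polynomial.aeval (tau A n a i) p = x := by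
  obtain ⟨p, rfl⟩ : ∃ p : (tailAlg a (i.1 + 1))[X], Polynomial.aeval (tau A n a i) p = x := by
    suffices h : tailAlg a i.1 ≤ ((Polynomial.aeval (R := tailAlg a (i.1 + 1))
        (tau A n a i)).restrictScalars A).range from h hx
    refine Algebra.adjoin_le ?_
    rintro _ ⟨j, hj, rfl⟩
    rcases hj.eq_or_lt with hj | hj
    · obtain rfl := Fin.ext hj
      exact ⟨Polynomial.X, by simp⟩
    · exact ⟨Polynomial.C ⟨tau A n a j, Algebra.subset_adjoin ⟨j, hj, rfl⟩⟩, by simp⟩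
  obtain ⟨q, hqm, hqd, hq, -⟩ := exists_tailAlg_factor a (m := i.1 + 1) i.2
  refine ⟨p %ₘ q, ?_, ?_⟩
  · have := Polynomial.natDegree_modByMonic_lt p hqm (fun h => by simp [h] at hqd)
    omega
  · refine Polynomial.aeval_modByMonic_eq_self_of_root ?_
    rw [← Polynomial.eval_map_algebraMap, hq, Polynomial.eval_prod]
    exact Finset.prod_eq_zero (Finset.self_mem_range_succ i.1) (by simp)

theorem mem_tailAlg_succ_of_invariant [Nontrivial (SplittingAlg A n a)] (i : Fin n)
    (hi : 2 ≤ i.1) {x : SplittingAlg A n a}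
    (hinv : ∀ σ : Equiv.Perm (Fin n), permHom A n a σ x = x) (hx : x ∈ tailAlg a i.1) :
    x ∈ tailAlg a (i.1 + 1) := by
  obtain ⟨p, hpd, hpx⟩ := exists_aeval_tau_eq a i hx
  obtain ⟨j, hj⟩ : ∃ j : Fin n, j.1 + 1 = i.1 := ⟨⟨i.1 - 1, by omega⟩, by simp only; omega⟩
  have hpj : Polynomial.aeval (tau A n a j) p = x := by
    have h := hinv (Equiv.swap j i)
    rw [← hpx, Polynomial.aeval_def, ← AlgHom.coe_toRingHom, Polynomial.hom_eval₂,
      AlgHom.coe_toRingHom, permHom_tau, Equiv.swap_apply_right] at h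
    rw [← hpx, Polynomial.aeval_def (tau A n a i), ← h, Polynomial.aeval_def]
    congr 1
    ext b
    exact (permHom_swap_eq_self a i j (Fin.le_def.2 (by omega)) b.2).symm
  set P := p.map (algebraMap _ (SplittingAlg A n a)) with hP
  set c := P.coeff i with hc
  obtain ⟨q, hqm, hqd, hq, -⟩ := exists_tailAlg_factor a (m := i.1) i.2.le
  have hPeq : P = Polynomial.C x + Polynomial.C c *
      ∏ l ∈ Finset.range i, (Polynomial.X - Polynomial.C (natTau a l)) := by
    let inc := Subalgebra.inclusion (tailAlg_anti a (Nat.le_succ i.1))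
    have hinc : (algebraMap (tailAlg a i.1) (SplittingAlg A n a)).comp (inc : _ →+* _) =
      algebraMap (tailAlg a (i.1 + 1)) _ := rfl
    let c' := inc (p.coeff i)
    let r := p.map (inc : _ →+* _) - (Polynomial.C ⟨x, hx⟩ + Polynomial.C c' * q)
    have hr : r.map (algebraMap _ (SplittingAlg A n a)) =
        P - (Polynomial.C x + Polynomial.C c *
          ∏ l ∈ Finset.range i, (Polynomial.X - Polynomial.C (natTau a l))) := by
      rw [Polynomial.map_sub, Polynomial.map_add, Polynomial.map_mul, Polynomial.map_C,
        Polynomial.map_C, hq, Polynomial.map_map, hinc, hc, hP, Polynomial.coeff_map]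
      rfl
    have hr0 : r = 0 := by
      refine eq_zero_of_aeval_tau_eq_zero a j hj r ?_ ?_
      · have hle : r.natDegree ≤ i := by
          refine (Polynomial.natDegree_sub_le _ _).trans (max_le ?_ ?_)
          · exact Polynomial.natDegree_map_le.trans hpd
          · refine (Polynomial.natDegree_add_le _ _).trans (max_le (by simp) ?_)
            exact (Polynomial.natDegree_C_mul_le _ _).trans hqd.le
        have hlead : r.coeff i = 0 := by
          have hq1 : q.coeff i = 1 := by
            simpa only [hqd] using hqm.coeff_natDegree
          simp only [r, Polynomial.coeff_sub, Polynomial.coeff_add, Polynomial.coeff_C_mul, hq1,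
            Polynomial.coeff_map, Polynomial.coeff_C_of_ne_zero (show i.1 ≠ 0 by omega)]
          simp [c']
        by_contra hlt
        have hri : r.natDegree = i := by omega
        have hr0 : r = 0 := by
          rw [← Polynomial.leadingCoeff_eq_zero, Polynomial.leadingCoeff]
          simpa only [hri] using hlead
        rw [hr0, Polynomial.natDegree_zero] at hri
        omega
      · rw [← Polynomial.eval_map_algebraMap, hr, Polynomial.eval_sub, Polynomial.eval_add,
          Polynomial.eval_mul, Polynomial.eval_prod, hP, Polynomial.eval_map_algebraMap, hpj,
          Finset.prod_eq_zero (Finset.mem_range.2 (show j.1 < i.1 by omega)) (by simp)]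
        simp
    rw [← sub_eq_zero, ← hr, hr0, Polynomial.map_zero]
  have hc0 : c = 0 := by
    have hco := congrArg (fun r => Polynomial.coeff r j) hPeq
    have h2 := Polynomial.prod_X_sub_C_coeff_card_pred (Finset.range i) (natTau a)
      (by simp; omega)
    rw [Finset.card_range, show i.1 - 1 = j by omega] at h2
    simp only [Polynomial.coeff_add, Polynomial.coeff_C_mul, h2] at hco
    rw [Polynomial.coeff_C_of_ne_zero (by omega), zero_add] at hco
    have hmem : ∀ l, P.coeff l ∈ tailAlg a (i.1 + 1) := fun l => by
      rw [hP, Polynomial.coeff_map]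
      exact Subtype.property _
    have hb : -(c * ∑ l ∈ Finset.range (i.1 + 1), natTau a l) - P.coeff j ∈ tailAlg a (i.1 + 1) :=
      sub_mem (neg_mem (mul_mem (hmem _) (sum_natTau_mem_tailAlg a i.2))) (hmem _)
    have hlin := eq_zero_of_aeval_tau_eq_zero a i rfl
      (Polynomial.C ⟨c, hmem _⟩ * Polynomial.X + Polynomial.C ⟨_, hb⟩)
      (Polynomial.natDegree_linear_le.trans (by omega)) (by
        rw [map_add, map_mul, Polynomial.aeval_C, Polynomial.aeval_C, Polynomial.aeval_X]
        change c * _ + (-(c * _) - _) = 0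
        rw [hco, Finset.sum_range_succ, natTau_val]
        ring)
    have hcoeff := congrArg (fun r => Polynomial.coeff r 1) hlin
    simp only [Polynomial.coeff_add, Polynomial.coeff_C_mul, Polynomial.coeff_X_one, mul_one,
      Polynomial.coeff_C_of_ne_zero one_ne_zero, add_zero, Polynomial.coeff_zero] at hcoeff
    exact congrArg Subtype.val hcoeff
  rw [hc0, map_zero, zero_mul, add_zero] at hPeq
  have h7 := congrArg (fun r => Polynomial.coeff r 0) hPeq
  simp only [hP, Polynomial.coeff_map, Polynomial.coeff_C_zero] at h7
  rw [← h7]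
  exact Subtype.property _

end Splitting

/-- For `2 ≤ k ≤ n`, every `S_n`-invariant element of `A_f` lying in the
`A`-subalgebra generated by `{τ_j : k ≤ j}` lies in the image of `algebraMap A A_f`. -/
theorem invariant_in_adjoin_tail_roots (A : Type*) [CommRing A] (n : ℕ) (hn : 1 ≤ n)
    (a : Fin n → A) (k : ℕ) (hk2 : 2 ≤ k) (hkn : k ≤ n) (x : SplittingAlg A n a)
    (hinv : ∀ σ : Equiv.Perm (Fin n), permHom A n a σ x = x)
    (hadj : x ∈ Algebra.adjoin A {y : SplittingAlg A n a |
      ∃ j : Fin n, k ≤ (j : ℕ) ∧ y = tau A n a j}) :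
    x ∈ Set.range (algebraMap A (SplittingAlg A n a)) := by
  rcases subsingleton_or_nontrivial (SplittingAlg A n a) with _ | _
  · exact ⟨0, Subsingleton.elim _ _⟩
  have key : ∀ m, k ≤ m → m ≤ n → x ∈ tailAlg a m := by
    intro m hm
    induction m, hm using Nat.le_induction with
    | base => exact fun _ => hadj
    | succ m hm ih =>
      intro hmn
      exact mem_tailAlg_succ_of_invariant a ⟨m, hmn⟩ (hk2.trans hm) hinv (ih (by omega))
  have h := key n hkn le_rfl
  have he : {y : SplittingAlg A n a | ∃ j : Fin n, n ≤ (j : ℕ) ∧ y = tau A n a j} = ∅ :=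
    Set.eq_empty_of_forall_notMem fun y ⟨j, hj, _⟩ => by omega
  rw [tailAlg, he, Algebra.adjoin_empty] at h
  exact Algebra.mem_bot.1 h
end

section
/- Assume n ≥ 2, let σ := Equiv.swap (n−2) (n−1), let H be the subgroup of S_n consisting of permutations fixing both n−2 and n−1, and let G be the subgroup of S_n generated by H and σ. Let x ∈ A_f be a trivial H-invariant that is invariant under σ, and let T be a finite subset of S_n containing exactly one representative of each left coset of G in S_n. Then there exists a trivial ⟨σ⟩-invariant y ∈ A_f such that ∑_{ρ ∈ T} ρ·x = x + y. -/
open MvPolynomial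

theorem Finset.sum_mem_of_involution {ι M : Type*} [AddCommMonoid M]
    (S : AddSubmonoid M) (f : ι → M) (g : ι → ι) (s : Finset ι) (hg : ∀ i ∈ s, g i ∈ s)
    (hgg : ∀ i ∈ s, g (g i) = i) (hfix : ∀ i ∈ s, g i = i → f i ∈ S)
    (hpair : ∀ i ∈ s, g i ≠ i → f i + f (g i) ∈ S) : ∑ i ∈ s, f i ∈ S := by
  classical
  induction s using Finset.strongInduction with
  | H s ih =>
    rcases s.eq_empty_or_nonempty with rfl | ⟨i, hi⟩
    · simp
    by_cases hgi : g i = i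
    · rw [← Finset.add_sum_erase s f hi]
      refine S.add_mem (hfix i hi hgi) (ih _ (Finset.erase_ssubset hi) ?_ ?_ ?_ ?_)
      · intro j hj
        have hj' := Finset.mem_of_mem_erase hj
        refine Finset.mem_erase.2 ⟨fun h => Finset.ne_of_mem_erase hj ?_, hg j hj'⟩
        rw [← hgg j hj', h, hgi]
      · exact fun j hj => hgg j (Finset.mem_of_mem_erase hj)
      · exact fun j hj => hfix j (Finset.mem_of_mem_erase hj)
      · exact fun j hj => hpair j (Finset.mem_of_mem_erase hj)
    · have hi' : g i ∈ s.erase i := Finset.mem_erase.2 ⟨hgi, hg i hi⟩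
      have hsub : ∀ j ∈ (s.erase i).erase (g i), j ∈ s := fun j hj =>
        Finset.mem_of_mem_erase (Finset.mem_of_mem_erase hj)
      rw [← Finset.add_sum_erase s f hi, ← Finset.add_sum_erase _ f hi', ← add_assoc]
      refine S.add_mem (hpair i hi hgi)
        (ih _ ((Finset.erase_ssubset hi').trans (Finset.erase_ssubset hi)) ?_ ?_ ?_ ?_)
      · intro j hj
        have hj' := hsub j hj
        refine Finset.mem_erase.2 ⟨fun h => ?_, Finset.mem_erase.2 ⟨fun h => ?_, hg j hj'⟩⟩
        · refine Finset.ne_of_mem_erase (Finset.mem_of_mem_erase hj) ?_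
          rw [← hgg j hj', h, hgg i hi]
        · refine Finset.ne_of_mem_erase hj ?_
          rw [← hgg j hj', h]
      · exact fun j hj => hgg j (hsub j hj)
      · exact fun j hj => hfix j (hsub j hj)
      · exact fun j hj => hpair j (hsub j hj)

theorem Equiv.Perm.mem_stabilizer_inf_sup_closure_swap_iff {α : Type*} [DecidableEq α] {u v : α}
    {g : Equiv.Perm α} :
    g ∈ (MulAction.stabilizer (Equiv.Perm α) u ⊓ MulAction.stabilizer (Equiv.Perm α) v) ⊔
        Subgroup.closure {Equiv.swap u v} ↔
      (g u = u ∧ g v = v) ∨ (g u = v ∧ g v = u) := by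
  constructor
  · let K : Subgroup (Equiv.Perm α) :=
      { carrier := {g | (g u = u ∧ g v = v) ∨ (g u = v ∧ g v = u)}
        one_mem' := by simp
        mul_mem' := by
          rintro g h (⟨h1, h2⟩ | ⟨h1, h2⟩) (⟨h3, h4⟩ | ⟨h3, h4⟩) <;> simp [h1, h2, h3, h4]
        inv_mem' := by
          rintro g (⟨h1, h2⟩ | ⟨h1, h2⟩)
          · exact Or.inl ⟨Equiv.Perm.inv_eq_iff_eq.2 h1.symm, Equiv.Perm.inv_eq_iff_eq.2 h2.symm⟩
          · exact Or.inr ⟨Equiv.Perm.inv_eq_iff_eq.2 h2.symm, Equiv.Perm.inv_eq_iff_eq.2 h1.symm⟩ }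
    have hK : (MulAction.stabilizer (Equiv.Perm α) u ⊓ MulAction.stabilizer (Equiv.Perm α) v) ⊔
        Subgroup.closure {Equiv.swap u v} ≤ K := by
      refine sup_le (fun h hh => Or.inl hh) ((Subgroup.closure_le _).2 ?_)
      rintro _ rfl
      exact Or.inr ⟨Equiv.swap_apply_left u v, Equiv.swap_apply_right u v⟩
    exact fun hg => hK hg
  · have hs : Equiv.swap u v ∈ Subgroup.closure {Equiv.swap u v} :=
      Subgroup.subset_closure rfl
    rintro (h | ⟨h1, h2⟩)
    · exact Subgroup.mem_sup_left h
    · rw [← mul_inv_cancel_right g (Equiv.swap u v)]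
      refine Subgroup.mul_mem_sup ?_ (inv_mem hs)
      exact ⟨by simp [MulAction.mem_stabilizer_iff, h2],
        by simp [MulAction.mem_stabilizer_iff, h1]⟩

section SplittingAlg

variable {A : Type*} [CommRing A] {n : ℕ} {a : Fin n → A}

theorem permHom_splittingMk (σ : Equiv.Perm (Fin n)) (p : MvPolynomial (Fin n) A) :
    permHom A n a σ (splittingMk A n a p) = splittingMk A n a (rename σ p) :=
  rfl

theorem permHom_mul_apply (σ τ : Equiv.Perm (Fin n)) (x : SplittingAlg A n a) :
    permHom A n a (σ * τ) x = permHom A n a σ (permHom A n a τ x) := by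
  obtain ⟨p, rfl⟩ : ∃ p, splittingMk A n a p = x := Ideal.Quotient.mk_surjective x
  simp only [permHom_splittingMk, rename_rename, Equiv.Perm.coe_mul]

theorem permHom_one_apply (x : SplittingAlg A n a) : permHom A n a 1 x = x := by
  obtain ⟨p, rfl⟩ : ∃ p, splittingMk A n a p = x := Ideal.Quotient.mk_surjective x
  simp [permHom_splittingMk]

variable (a) in
/-- The subgroup of permutations fixing an element of the splitting algebra. -/
def permHomStabilizer (x : SplittingAlg A n a) : Subgroup (Equiv.Perm (Fin n)) where
  carrier := {σ | permHom A n a σ x = x}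
  one_mem' := permHom_one_apply x
  mul_mem' {σ τ} hσ hτ := by
    simp only [Set.mem_ofPred_eq] at hσ hτ ⊢
    rw [permHom_mul_apply, hτ, hσ]
  inv_mem' {σ} hσ := by
    simp only [Set.mem_ofPred_eq] at hσ ⊢
    conv_lhs => rw [← hσ]
    rw [← permHom_mul_apply, inv_mul_cancel, permHom_one_apply]

variable (A n a) in
/-- The trivial `G`-invariants as an additive submonoid. -/
def trivialInvAddSubmonoid (G : Subgroup (Equiv.Perm (Fin n))) :
    AddSubmonoid (SplittingAlg A n a) where
  carrier := trivialInv A n a G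
  zero_mem' := ⟨0, fun _ _ => map_zero _, map_zero _⟩
  add_mem' := by
    rintro _ _ ⟨p, hp, rfl⟩ ⟨q, hq, rfl⟩
    exact ⟨p + q, fun σ hσ => by rw [map_add, hp σ hσ, hq σ hσ], map_add _ _ _⟩

theorem splittingMk_mem_trivialInv_closure {σ : Equiv.Perm (Fin n)} {p : MvPolynomial (Fin n) A}
    (hp : rename σ p = p) :
    splittingMk A n a p ∈ trivialInv A n a (Subgroup.closure {σ}) := by
  refine ⟨p, fun τ hτ => ?_, rfl⟩
  induction hτ using Subgroup.closure_induction with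
  | mem τ h => rw [Set.mem_singleton_iff.1 h, hp]
  | one => simp
  | mul τ υ _ _ hτ hυ => rw [Equiv.Perm.coe_mul, ← rename_rename, hυ, hτ]
  | inv τ _ hτ =>
    conv_lhs => rw [← hτ]
    rw [rename_rename, ← Equiv.Perm.coe_mul, inv_mul_cancel, Equiv.Perm.coe_one, rename_id_apply]

theorem exists_trivialInv_coset_sum_eq {u v : Fin n} (x : SplittingAlg A n a)
    (htriv : x ∈ trivialInv A n a
      (MulAction.stabilizer (Equiv.Perm (Fin n)) u ⊓ MulAction.stabilizer (Equiv.Perm (Fin n)) v))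
    (hinv : permHom A n a (Equiv.swap u v) x = x) (T : Finset (Equiv.Perm (Fin n)))
    (hT : ∀ ρ : Equiv.Perm (Fin n), ∃! t, t ∈ T ∧ ρ⁻¹ * t ∈
      (MulAction.stabilizer (Equiv.Perm (Fin n)) u ⊓ MulAction.stabilizer (Equiv.Perm (Fin n)) v) ⊔
        Subgroup.closure {Equiv.swap u v}) :
    ∃ y ∈ trivialInv A n a (Subgroup.closure {Equiv.swap u v}),
      ∑ ρ ∈ T, permHom A n a ρ x = x + y := by
  set G := (MulAction.stabilizer (Equiv.Perm (Fin n)) u ⊓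
    MulAction.stabilizer (Equiv.Perm (Fin n)) v) ⊔ Subgroup.closure {Equiv.swap u v} with hG
  set σ := Equiv.swap u v with hσ
  have hσG : σ ∈ G := Subgroup.mem_sup_right (Subgroup.subset_closure rfl)
  have hσσ : σ * σ = 1 := Equiv.swap_mul_self u v
  obtain ⟨p, hp, rfl⟩ := htriv
  have hGx : ∀ g ∈ G, permHom A n a g (splittingMk A n a p) = splittingMk A n a p := by
    have : G ≤ permHomStabilizer a (splittingMk A n a p) := by
      refine sup_le (fun h hh => ?_) ((Subgroup.closure_le _).2 ?_)
      · exact congrArg (splittingMk A n a) (hp h hh)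
      · rintro _ rfl
        exact hinv
    exact this
  have hcoset : ∀ ρ t : Equiv.Perm (Fin n), ρ⁻¹ * t ∈ G →
      permHom A n a t (splittingMk A n a p) = permHom A n a ρ (splittingMk A n a p) := by
    intro ρ t h
    rw [← mul_inv_cancel_left ρ t, permHom_mul_apply, hGx _ h]
  choose r hr hr_unique using hT
  have hrT : ∀ ρ, r ρ ∈ T := fun ρ => (hr ρ).1
  have hrG : ∀ ρ, ρ⁻¹ * r ρ ∈ G := fun ρ => (hr ρ).2
  have hr_eq : ∀ ρ, ∀ t ∈ T, ρ⁻¹ * t ∈ G → t = r ρ := fun ρ t ht h => hr_unique ρ t ⟨ht, h⟩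
  have hr_one : r 1 ∈ G := by simpa using hrG 1
  have hnot : ∀ t ∈ T.erase (r 1), t ∉ G := fun t ht htG =>
    Finset.ne_of_mem_erase ht (hr_eq 1 t (Finset.mem_of_mem_erase ht) (by simpa using htG))
  refine ⟨∑ ρ ∈ T.erase (r 1), permHom A n a ρ (splittingMk A n a p), ?_, ?_⟩
  · refine Finset.sum_mem_of_involution (trivialInvAddSubmonoid A n a (Subgroup.closure {σ})) _
      (fun t => r (σ * t)) _ ?_ ?_ ?_ ?_
    · intro t ht
      refine Finset.mem_erase.2 ⟨fun h => hnot t ht ?_, hrT _⟩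
      have h1 := hrG (σ * t)
      rw [h] at h1
      have h2 := (G.mul_mem_cancel_right hr_one).1 h1
      exact (G.mul_mem_cancel_left hσG).1 (G.inv_mem_iff.1 h2)
    · intro t ht
      refine (hr_eq _ t (Finset.mem_of_mem_erase ht) ?_).symm
      have h1 := G.inv_mem (hrG (σ * t))
      have hσi : σ⁻¹ = σ := Equiv.swap_inv u v
      simpa [mul_assoc, hσi] using h1
    · intro t ht hfix
      have h1 := hrG (σ * t)
      rw [hfix] at h1
      refine splittingMk_mem_trivialInv_closure ?_
      change rename σ (rename t p) = rename t p
      have hconj : σ * t = t * Equiv.swap (t⁻¹ u) (t⁻¹ v) := by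
        rw [hσ, Equiv.mul_swap_eq_swap_mul]
        simp
      have hmem : Equiv.swap (t⁻¹ u) (t⁻¹ v) ∈ G := by
        have := G.inv_mem h1
        rwa [mul_inv_rev, inv_inv, hconj, inv_mul_cancel_left] at this
      have htn : t⁻¹ ∉ G := fun h => hnot t ht (G.inv_mem_iff.1 h)
      rw [hG, hσ, Equiv.Perm.mem_stabilizer_inf_sup_closure_swap_iff] at hmem htn
      have hne : t⁻¹ u = t⁻¹ v ↔ u = v := (t⁻¹).injective.eq_iff
      have hswap : Equiv.swap (t⁻¹ u) (t⁻¹ v) ∈ MulAction.stabilizer (Equiv.Perm (Fin n)) u ⊓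
          MulAction.stabilizer (Equiv.Perm (Fin n)) v := by
        change Equiv.swap (t⁻¹ u) (t⁻¹ v) u = u ∧ Equiv.swap (t⁻¹ u) (t⁻¹ v) v = v
        simp only [Equiv.swap_apply_def] at hmem ⊢
        grind
      rw [rename_rename, ← Equiv.Perm.coe_mul, hconj, Equiv.Perm.coe_mul, ← rename_rename,
        hp _ hswap]
    · intro t _ _
      rw [hcoset _ _ (hrG (σ * t)), permHom_splittingMk, permHom_splittingMk, ← map_add]
      refine splittingMk_mem_trivialInv_closure ?_
      rw [map_add, rename_rename, rename_rename, ← Equiv.Perm.coe_mul, ← Equiv.Perm.coe_mul,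
        ← mul_assoc, hσσ, one_mul, add_comm]
  · rw [← Finset.add_sum_erase T _ (hrT 1), hGx _ hr_one]

end SplittingAlg

/-- For `n ≥ 2`, `σ := Equiv.swap (n-2) (n-1)`, `H` the subgroup of permutations
fixing `n-2` and `n-1`, and `G := ⟨H, σ⟩`: if `x` is a trivial `H`-invariant that is invariant
under `σ`, and `T` is a set of representatives of the left cosets of `G` in `S_n`, then
`∑_{ρ ∈ T} ρ·x = x + y` for some trivial `⟨σ⟩`-invariant `y`. -/
theorem coset_sum_eq_self_add_trivial (A : Type*) [CommRing A] (n : ℕ) (hn : 2 ≤ n)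
    (a : Fin n → A) (x : SplittingAlg A n a)
    (htriv : x ∈ trivialInv A n a
      (MulAction.stabilizer (Equiv.Perm (Fin n)) (⟨n - 2, by omega⟩ : Fin n) ⊓
       MulAction.stabilizer (Equiv.Perm (Fin n)) (⟨n - 1, by omega⟩ : Fin n)))
    (hinv : permHom A n a (Equiv.swap (⟨n - 2, by omega⟩ : Fin n) ⟨n - 1, by omega⟩) x = x)
    (T : Finset (Equiv.Perm (Fin n)))
    (hT : ∀ ρ : Equiv.Perm (Fin n), ∃! t, t ∈ T ∧ ρ⁻¹ * t ∈
      ((MulAction.stabilizer (Equiv.Perm (Fin n)) (⟨n - 2, by omega⟩ : Fin n) ⊓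
        MulAction.stabilizer (Equiv.Perm (Fin n)) (⟨n - 1, by omega⟩ : Fin n)) ⊔
       Subgroup.closure {Equiv.swap (⟨n - 2, by omega⟩ : Fin n) ⟨n - 1, by omega⟩})) :
    ∃ y ∈ trivialInv A n a
        (Subgroup.closure {Equiv.swap (⟨n - 2, by omega⟩ : Fin n) ⟨n - 1, by omega⟩}),
      ∑ ρ ∈ T, permHom A n a ρ x = x + y := by
  exact exists_trivialInv_coset_sum_eq x htriv hinv T hT
end
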